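/- For every γ > 0, t > 0 and every Borel set A ⊆ ℝ, ∫_ℝ γ e^{-2γ|x|} ( ∫_A p(t; x, y) · 2 e^{-2γ|y|} dy ) dx = ∫_A γ e^{-2γ|y|} dy, where p(t; x, y) = (1/(2√(2πt))) exp( γ(|x| + |y|) − (γ²/2) t − (x − y)²/(2t) ) + (γ/4) Erfc( (|x| + |y| − γt)/√(2t) ). -/

import Mathlib

open MeasureTheory Real Set

/-- The complementary error function `Erfc`. -/
noncomputable def erfc (x : ℝ) : ℝ :=
  (2 / Real.sqrt Real.pi) * ∫ u in Set.Ioi x, Real.exp (-u ^ 2)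

/-- The transition density `p(t; x, y)`, with respect to the speed measure
`m(dy) = 2 e^{-2γ|y|} dy`, of a Brownian motion with constant drift `γ` towards the origin. -/
noncomputable def transDensity (γ t x y : ℝ) : ℝ :=
  (1 / (2 * Real.sqrt (2 * Real.pi * t))) *
      Real.exp (γ * (|x| + |y|) - γ ^ 2 / 2 * t - (x - y) ^ 2 / (2 * t)) +
    (γ / 4) * erfc ((|x| + |y| - γ * t) / Real.sqrt (2 * t))

lemma aux_gauss_int : Integrable (fun u : ℝ => Real.exp (-u ^ 2)) := by
  have := integrable_exp_neg_mul_sq (b := 1) one_pos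
  simpa using this

lemma aux_erfc_eq (z : ℝ) :
    erfc z = (2 / Real.sqrt Real.pi) * ((∫ u in Set.Ioi (0:ℝ), Real.exp (-u ^ 2)) -
      ∫ u in (0:ℝ)..z, Real.exp (-u ^ 2)) := by
  unfold erfc
  rw [← intervalIntegral.integral_interval_add_Ioi (a := 0) (b := z) aux_gauss_int.integrableOn
    aux_gauss_int.integrableOn]
  ring

lemma aux_erfc_deriv (z : ℝ) :
    HasDerivAt erfc (-(2 / Real.sqrt Real.pi) * Real.exp (-z ^ 2)) z := by
  have h : HasDerivAt (fun z : ℝ => ∫ u in (0:ℝ)..z, Real.exp (-u ^ 2)) (Real.exp (-z ^ 2)) z := by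
    have hc : Continuous (fun u : ℝ => Real.exp (-u ^ 2)) := by fun_prop
    exact hc.integral_hasStrictDerivAt 0 z |>.hasDerivAt
  have h2 := (h.const_sub (∫ u in Set.Ioi (0:ℝ), Real.exp (-u ^ 2))).const_mul
    (2 / Real.sqrt Real.pi)
  have h3 : erfc = _ := funext aux_erfc_eq
  rw [h3]
  exact h2.congr_deriv (by ring)

lemma aux_erfc_cont : Continuous erfc :=
  continuous_iff_continuousAt.2 fun z => (aux_erfc_deriv z).continuousAt

lemma aux_erfc_tendsto : Filter.Tendsto erfc Filter.atTop (nhds 0) := by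
  have h3 : erfc = _ := funext aux_erfc_eq
  rw [h3]
  have h := intervalIntegral_tendsto_integral_Ioi (0:ℝ)
    (aux_gauss_int.integrableOn (s := Set.Ioi (0:ℝ))) Filter.tendsto_id
  have h2 := (h.const_sub (∫ u in Set.Ioi (0:ℝ), Real.exp (-u ^ 2))).const_mul
    (2 / Real.sqrt Real.pi)
  simpa using h2

lemma aux_erfc_nonneg (z : ℝ) : 0 ≤ erfc z := by
  unfold erfc
  have : 0 ≤ ∫ u in Set.Ioi z, Real.exp (-u ^ 2) :=
    integral_nonneg fun u => (Real.exp_pos _).le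
  positivity

lemma aux_erfc_add (z : ℝ) : erfc z + erfc (-z) = 2 := by
  unfold erfc
  have h1 := integral_comp_neg_Ioi (-z) (fun u : ℝ => Real.exp (-u ^ 2))
  simp only [neg_neg, neg_sq] at h1
  have h2 := intervalIntegral.integral_Iic_add_Ioi (b := z) aux_gauss_int.integrableOn
    aux_gauss_int.integrableOn
  have h3 := integral_gaussian 1
  have h4 : (fun x : ℝ => Real.exp (-1 * x ^ 2)) = fun x : ℝ => Real.exp (-x ^ 2) := by
    funext x; simp
  rw [h4, div_one] at h3
  rw [h1, ← mul_add, add_comm, h2, h3]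
  have : Real.sqrt Real.pi ≠ 0 := by positivity
  field_simp

lemma aux_split {f : ℝ → ℝ} (h1 : IntegrableOn f (Ioi 0))
    (h2 : IntegrableOn (fun x => f (-x)) (Ioi 0)) :
    Integrable f ∧ ∫ x, f x = (∫ x in Ioi 0, f x) + ∫ x in Ioi 0, f (-x) := by
  have h3 : IntegrableOn f (Iic 0) := by
    rw [integrableOn_Iic_iff_integrableOn_Iio]
    have h2' : IntegrableOn (fun x => f (-x)) (Ioi (-0)) := by simpa using h2
    have := h2'.comp_neg_Iio
    simpa using this
  constructor
  · rw [← integrableOn_univ, ← Iic_union_Ioi (a := (0:ℝ))]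
    exact h3.union h1
  · rw [integral_comp_neg_Ioi, neg_zero, add_comm, intervalIntegral.integral_Iic_add_Ioi h3 h1]

lemma aux_exp_int (γ : ℝ) (hγ : 0 < γ) : Integrable (fun x : ℝ => Real.exp (-2 * γ * |x|)) := by
  have h : IntegrableOn (fun x : ℝ => Real.exp (-2 * γ * |x|)) (Ioi 0) := by
    refine (integrableOn_exp_mul_Ioi (a := -2 * γ) (by linarith) 0).congr_fun ?_ measurableSet_Ioi
    intro x hx
    simp only
    rw [abs_of_pos hx]
  exact (aux_split h (by simpa using h)).1

/-- derivative of erfc of an affine map -/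
lemma aux_erfc_affine (s c x : ℝ) :
    HasDerivAt (fun x => erfc ((x + c) / s))
      (-(2 / Real.sqrt Real.pi) * Real.exp (-((x + c) / s) ^ 2) * (1 / s)) x := by
  have h : HasDerivAt (fun x : ℝ => (x + c) / s) (1 / s) x :=
    ((hasDerivAt_id x).add_const c).div_const s
  exact (aux_erfc_deriv _).comp x h

lemma aux_erfc_affine_tendsto (s c : ℝ) (hs : 0 < s) :
    Filter.Tendsto (fun x => erfc ((x + c) / s)) Filter.atTop (nhds 0) :=
  aux_erfc_tendsto.comp
    ((Filter.tendsto_atTop_add_const_right _ c Filter.tendsto_id).atTop_div_const hs)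

noncomputable def auxF (γ t y x : ℝ) : ℝ := transDensity γ t x y * (2 * Real.exp (-2 * γ * |x|))

lemma aux_trans_nonneg (γ t x y : ℝ) (hγ : 0 < γ) : 0 ≤ transDensity γ t x y := by
  unfold transDensity
  have := aux_erfc_nonneg ((|x| + |y| - γ * t) / Real.sqrt (2 * t))
  positivity

lemma auxF_nonneg (γ t y x : ℝ) (hγ : 0 < γ) : 0 ≤ auxF γ t y x := by
  unfold auxF
  have := aux_trans_nonneg γ t x y hγ
  positivity

/-- antiderivative of the erfc part -/
noncomputable def auxE (γ t a x : ℝ) : ℝ :=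
  -(1/4) * (Real.exp (-2 * γ * x) * erfc ((x + (a - γ * t)) / Real.sqrt (2 * t))) +
    (1/4) * Real.exp (2 * γ * a) * erfc ((x + (a + γ * t)) / Real.sqrt (2 * t))

lemma aux_sq (t c : ℝ) (ht : 0 < t) : (c / Real.sqrt (2 * t)) ^ 2 = c ^ 2 / (2 * t) := by
  rw [div_pow, Real.sq_sqrt (by positivity)]

lemma auxE_deriv (γ t a x : ℝ) (ht : 0 < t) :
    HasDerivAt (auxE γ t a)
      (γ / 2 * (Real.exp (-2 * γ * x) * erfc ((x + (a - γ * t)) / Real.sqrt (2 * t)))) x := by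
  have he : HasDerivAt (fun x : ℝ => Real.exp (-2 * γ * x)) (Real.exp (-2 * γ * x) * (-2 * γ)) x := by
    have := ((hasDerivAt_id x).const_mul (-2 * γ)).exp
    simpa using this
  have h := ((he.mul (aux_erfc_affine (Real.sqrt (2 * t)) (a - γ * t) x)).const_mul (-(1/4))).add
    ((aux_erfc_affine (Real.sqrt (2 * t)) (a + γ * t) x).const_mul ((1/4) * Real.exp (2 * γ * a)))
  have key : Real.exp (-2 * γ * x) * Real.exp (-((x + (a - γ * t)) / Real.sqrt (2 * t)) ^ 2) =
      Real.exp (2 * γ * a) * Real.exp (-((x + (a + γ * t)) / Real.sqrt (2 * t)) ^ 2) := by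
    rw [aux_sq _ _ ht, aux_sq _ _ ht, ← Real.exp_add, ← Real.exp_add]
    congr 1
    field_simp
    ring
  convert! h using 1
  linear_combination (-(1/4) * (2 / Real.sqrt Real.pi) * (1 / Real.sqrt (2 * t))) * key

lemma auxE_tendsto (γ t a : ℝ) (hγ : 0 < γ) (ht : 0 < t) :
    Filter.Tendsto (auxE γ t a) Filter.atTop (nhds 0) := by
  have hs : 0 < Real.sqrt (2 * t) := by positivity
  have he : Filter.Tendsto (fun x : ℝ => Real.exp (-2 * γ * x)) Filter.atTop (nhds 0) := by
    refine Real.tendsto_exp_atBot.comp ?_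
    exact Filter.tendsto_id.const_mul_atTop_of_neg (by linarith)
  have h := ((he.mul (aux_erfc_affine_tendsto _ (a - γ * t) hs)).const_mul (-(1/4))).add
    ((aux_erfc_affine_tendsto _ (a + γ * t) hs).const_mul ((1/4) * Real.exp (2 * γ * a)))
  simp only [mul_zero, add_zero] at h
  exact h

lemma aux_sqrt (t : ℝ) : Real.sqrt (2 * Real.pi * t) = Real.sqrt Real.pi * Real.sqrt (2 * t) := by
  rw [← Real.sqrt_mul Real.pi_pos.le]; congr 1; ring

lemma auxF_pos_eq (γ t a x : ℝ) (ht : 0 < t) (ha : 0 ≤ a) (hx : 0 ≤ x) :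
    auxF γ t a x = -(1/2) * (-(2 / Real.sqrt Real.pi) *
        Real.exp (-((x + (γ * t - a)) / Real.sqrt (2 * t)) ^ 2) * (1 / Real.sqrt (2 * t))) +
      γ / 2 * (Real.exp (-2 * γ * x) * erfc ((x + (a - γ * t)) / Real.sqrt (2 * t))) := by
  unfold auxF transDensity
  rw [abs_of_nonneg ha, abs_of_nonneg hx, aux_sq _ _ ht, aux_sqrt]
  have key : Real.exp (γ * (x + a) - γ ^ 2 / 2 * t - (x - a) ^ 2 / (2 * t)) *
      Real.exp (-2 * γ * x) = Real.exp (-((x + (γ * t - a)) ^ 2 / (2 * t))) := by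
    rw [← Real.exp_add]
    congr 1
    field_simp
    ring
  rw [← key, show x + (a - γ * t) = x + a - γ * t by ring]
  have h1 : Real.sqrt Real.pi ≠ 0 := by positivity
  have h2 : Real.sqrt (2 * t) ≠ 0 := by positivity
  field_simp
  ring

lemma auxF_neg_eq (γ t a x : ℝ) (ht : 0 < t) (ha : 0 ≤ a) (hx : 0 ≤ x) :
    auxF γ t a (-x) = -(1/2) * Real.exp (2 * γ * a) * (-(2 / Real.sqrt Real.pi) *
        Real.exp (-((x + (a + γ * t)) / Real.sqrt (2 * t)) ^ 2) * (1 / Real.sqrt (2 * t))) +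
      γ / 2 * (Real.exp (-2 * γ * x) * erfc ((x + (a - γ * t)) / Real.sqrt (2 * t))) := by
  unfold auxF transDensity
  rw [abs_neg, abs_of_nonneg ha, abs_of_nonneg hx, aux_sq _ _ ht, aux_sqrt]
  have key : Real.exp (γ * (x + a) - γ ^ 2 / 2 * t - (-x - a) ^ 2 / (2 * t)) *
      Real.exp (-2 * γ * x) =
      Real.exp (2 * γ * a) * Real.exp (-((x + (a + γ * t)) ^ 2 / (2 * t))) := by
    rw [← Real.exp_add, ← Real.exp_add]
    congr 1
    field_simp
    ring
  rw [show x + (a - γ * t) = x + a - γ * t by ring]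
  have h1 : Real.sqrt Real.pi ≠ 0 := by positivity
  have h2 : Real.sqrt (2 * t) ≠ 0 := by positivity
  linear_combination (exp := 1) (1 / (Real.sqrt Real.pi * Real.sqrt (2 * t))) * key

lemma auxF_integral_nonneg (γ t a : ℝ) (hγ : 0 < γ) (ht : 0 < t) (ha : 0 ≤ a) :
    Integrable (auxF γ t a) ∧ ∫ x, auxF γ t a x = 1 := by
  have hs : 0 < Real.sqrt (2 * t) := by positivity
  have d1 : ∀ x ∈ Ici (0:ℝ), HasDerivAt
      (fun x => -(1/2) * erfc ((x + (γ * t - a)) / Real.sqrt (2 * t)) + auxE γ t a x)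
      (auxF γ t a x) x := by
    intro x hx
    rw [auxF_pos_eq γ t a x ht ha hx]
    exact ((aux_erfc_affine _ _ x).const_mul _).add (auxE_deriv γ t a x ht)
  have d2 : ∀ x ∈ Ici (0:ℝ), HasDerivAt
      (fun x => -(1/2) * Real.exp (2 * γ * a) * erfc ((x + (a + γ * t)) / Real.sqrt (2 * t)) +
        auxE γ t a x)
      (auxF γ t a (-x)) x := by
    intro x hx
    rw [auxF_neg_eq γ t a x ht ha hx]
    exact ((aux_erfc_affine _ _ x).const_mul _).add (auxE_deriv γ t a x ht)
  have l1 := ((aux_erfc_affine_tendsto _ (γ * t - a) hs).const_mul (-(1/2))).add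
    (auxE_tendsto γ t a hγ ht)
  have l2 := ((aux_erfc_affine_tendsto _ (a + γ * t) hs).const_mul
    (-(1/2) * Real.exp (2 * γ * a))).add (auxE_tendsto γ t a hγ ht)
  have i1 := integrableOn_Ioi_deriv_of_nonneg' d1 (fun x _ => auxF_nonneg γ t a x hγ) l1
  have i2 := integrableOn_Ioi_deriv_of_nonneg' d2 (fun x _ => auxF_nonneg γ t a (-x) hγ) l2
  have e1 := integral_Ioi_of_hasDerivAt_of_nonneg' d1 (fun x _ => auxF_nonneg γ t a x hγ) l1
  have e2 := integral_Ioi_of_hasDerivAt_of_nonneg' d2 (fun x _ => auxF_nonneg γ t a (-x) hγ) l2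
  obtain ⟨h1, h2⟩ := aux_split i1 i2
  refine ⟨h1, ?_⟩
  rw [h2, e1, e2]
  have h3 := aux_erfc_add ((a - γ * t) / Real.sqrt (2 * t))
  rw [← neg_div, neg_sub] at h3
  simp only [auxE, zero_add, mul_zero, Real.exp_zero]
  linear_combination (1/2) * h3

lemma auxF_integral (γ t y : ℝ) (hγ : 0 < γ) (ht : 0 < t) :
    Integrable (auxF γ t y) ∧ ∫ x, auxF γ t y x = 1 := by
  rcases le_total 0 y with hy | hy
  · exact auxF_integral_nonneg γ t y hγ ht hy
  · obtain ⟨h1, h2⟩ := auxF_integral_nonneg γ t (-y) hγ ht (by linarith)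
    have h : auxF γ t y = fun x => auxF γ t (-y) (-x) := by
      funext x
      unfold auxF transDensity
      rw [abs_neg, abs_neg, show (-x - -y) ^ 2 = (x - y) ^ 2 by ring]
    rw [h]
    exact ⟨h1.comp_neg, by rw [integral_neg_eq_self (fun x => auxF γ t (-y) x)]; exact h2⟩

/-- `π(dx) = γ e^{-2γ|x|} dx` is a stationary probability measure for the Brownian motion with
constant drift `γ` towards the origin. -/
theorem transDensity_stationary (γ t : ℝ) (hγ : 0 < γ) (ht : 0 < t)
    (A : Set ℝ) (hA : MeasurableSet A) :
    (∫ x : ℝ, γ * Real.exp (-2 * γ * |x|) *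
        ∫ y in A, transDensity γ t x y * (2 * Real.exp (-2 * γ * |y|))) =
      ∫ y in A, γ * Real.exp (-2 * γ * |y|) := by
  have hF : ∀ x y : ℝ, γ * Real.exp (-2 * γ * |x|) *
      (transDensity γ t x y * (2 * Real.exp (-2 * γ * |y|))) =
      γ * Real.exp (-2 * γ * |y|) * auxF γ t y x := by
    intro x y
    unfold auxF
    ring
  simp_rw [← integral_const_mul, hF]
  have hc : Continuous (Function.uncurry
      (fun x y : ℝ => γ * Real.exp (-2 * γ * |y|) * auxF γ t y x)) := by
    have := aux_erfc_cont
    unfold auxF transDensity Function.uncurry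
    fun_prop
  rw [integral_integral_swap]
  · refine integral_congr_ae (Filter.Eventually.of_forall fun y => ?_)
    simp only
    rw [integral_const_mul, (auxF_integral γ t _ hγ ht).2, mul_one]
    try ring
  · rw [integrable_prod_iff' hc.aestronglyMeasurable]
    constructor
    · exact Filter.Eventually.of_forall fun y =>
        (auxF_integral γ t y hγ ht).1.const_mul (γ * Real.exp (-2 * γ * |y|))
    · have : (fun y : ℝ => ∫ x : ℝ, ‖Function.uncurry
          (fun x y : ℝ => γ * Real.exp (-2 * γ * |y|) * auxF γ t y x) (x, y)‖) =
          fun y => γ * Real.exp (-2 * γ * |y|) := by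
        funext y
        have h : ∀ x : ℝ, ‖Function.uncurry
          (fun x y : ℝ => γ * Real.exp (-2 * γ * |y|) * auxF γ t y x) (x, y)‖ =
            γ * Real.exp (-2 * γ * |y|) * auxF γ t y x := by
          intro x
          have := auxF_nonneg γ t y x hγ
          have h0 : 0 ≤ γ * Real.exp (-2 * γ * |y|) * auxF γ t y x := by positivity
          exact Real.norm_of_nonneg h0
        simp_rw [h, integral_const_mul, (auxF_integral γ t _ hγ ht).2, mul_one]
      rw [this]
      exact ((aux_exp_int γ hγ).const_mul γ).integrableOn
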